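/- arXiv:1706.04901 — 5 statements merged into one kernel-verified Lean document; each statement's English description precedes it below -/
import Mathlib

section
/- Let n ≥ 1, let E and F be Köthe sequence spaces, let α ∈ ℂ^ℕ and C ≥ 0. Assume that for every N ∈ ℕ and all x_1,…,x_n ∈ E with ‖x_i‖_E ≤ 1 and x_i(k) = 0 for all k > N (i = 1,…,n), one has α·x_1⋯x_n ∈ F and ‖α·x_1⋯x_n‖_F ≤ C. Then for all x_1,…,x_n ∈ E one has α·x_1⋯x_n ∈ F^{××} and ‖α·x_1⋯x_n‖_{F^{××}} ≤ C·‖x_1‖_E⋯‖x_n‖_E. (This is the paper's Density Lemma in the case of the ideal of all bounded multilinear operators.) -/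
/-- A Köthe sequence space: a linear subspace of `ℂ^ℕ` with a complete norm such that
`ℓ₁ ⊆ E ⊆ ℓ_∞` with inclusions of norm at most 1, and which is normal. -/
structure KotheSpace : Type where
  Mem : (ℕ → ℂ) → Prop
  nrm : (ℕ → ℂ) → ℝ
  mem_zero : Mem 0
  mem_add : ∀ {x y : ℕ → ℂ}, Mem x → Mem y → Mem (x + y)
  mem_smul : ∀ (c : ℂ) {x : ℕ → ℂ}, Mem x → Mem (c • x)
  nrm_add_le : ∀ {x y : ℕ → ℂ}, Mem x → Mem y → nrm (x + y) ≤ nrm x + nrm y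
  nrm_smul : ∀ (c : ℂ) {x : ℕ → ℂ}, Mem x → nrm (c • x) = ‖c‖ * nrm x
  nrm_eq_zero_iff : ∀ {x : ℕ → ℂ}, Mem x → (nrm x = 0 ↔ x = 0)
  l1_mem : ∀ {x : ℕ → ℂ}, Summable (fun k => ‖x k‖) → Mem x
  nrm_le_l1 : ∀ {x : ℕ → ℂ}, Summable (fun k => ‖x k‖) → nrm x ≤ ∑' k, ‖x k‖
  coord_le_nrm : ∀ {x : ℕ → ℂ}, Mem x → ∀ k, ‖x k‖ ≤ nrm x
  normal_mem : ∀ {x y : ℕ → ℂ}, Mem y → (∀ k, ‖x k‖ ≤ ‖y k‖) → Mem x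
  normal_nrm : ∀ {x y : ℕ → ℂ}, Mem x → Mem y → (∀ k, ‖x k‖ ≤ ‖y k‖) → nrm x ≤ nrm y
  complete : ∀ f : ℕ → ℕ → ℂ, (∀ i, Mem (f i)) →
    (∀ ε : ℝ, 0 < ε → ∃ N, ∀ i, N ≤ i → ∀ j, N ≤ j → nrm (f i - f j) < ε) →
    ∃ g, Mem g ∧ ∀ ε : ℝ, 0 < ε → ∃ N, ∀ i, N ≤ i → nrm (f i - g) < ε

namespace KotheSpace

/-- Membership in the Köthe dual `E^×`. -/
def dualMem (E : KotheSpace) (z : ℕ → ℂ) : Prop :=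
  ∀ x, E.Mem x → Summable fun k => ‖z k * x k‖

/-- The norm of the Köthe dual `E^×`. -/
noncomputable def dualNrm (E : KotheSpace) (z : ℕ → ℂ) : ℝ :=
  sSup {r | ∃ x, E.Mem x ∧ E.nrm x ≤ 1 ∧ r = ∑' k, ‖z k * x k‖}

/-- Membership in the Köthe bidual `E^××`. -/
def bidualMem (E : KotheSpace) (z : ℕ → ℂ) : Prop :=
  ∀ w, E.dualMem w → Summable fun k => ‖z k * w k‖

/-- The norm of the Köthe bidual `E^××`. -/
noncomputable def bidualNrm (E : KotheSpace) (z : ℕ → ℂ) : ℝ :=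
  sSup {r | ∃ w, E.dualMem w ∧ E.dualNrm w ≤ 1 ∧ r = ∑' k, ‖z k * w k‖}

end KotheSpace

open scoped BigOperators

namespace KotheSpace

theorem nrm_nonneg (E : KotheSpace) {x : ℕ → ℂ} (hx : E.Mem x) : 0 ≤ E.nrm x :=
  (norm_nonneg _).trans (E.coord_le_nrm hx 0)

theorem mem_sub (E : KotheSpace) {x y : ℕ → ℂ} (hx : E.Mem x) (hy : E.Mem y) : E.Mem (x - y) := by
  have := E.mem_add hx (E.mem_smul (-1) hy)
  rwa [neg_one_smul, ← sub_eq_add_neg] at this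

theorem nrm_sub_comm (E : KotheSpace) {x y : ℕ → ℂ} (hx : E.Mem x) (hy : E.Mem y) :
    E.nrm (x - y) = E.nrm (y - x) := by
  have := E.nrm_smul (-1) (E.mem_sub hy hx)
  simpa using this

theorem mem_sum (E : KotheSpace) {f : ℕ → ℕ → ℂ} (hf : ∀ m, E.Mem (f m)) (n : ℕ) :
    E.Mem (∑ m ∈ Finset.range n, f m) := by
  induction n with
  | zero => simpa using E.mem_zero
  | succ n ih => rw [Finset.sum_range_succ]; exact E.mem_add ih (hf n)

/-- The vector `x / ‖x‖`, equal to `0` when `x = 0`. -/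
noncomputable def normalize (E : KotheSpace) (x : ℕ → ℂ) : ℕ → ℂ :=
  ((E.nrm x)⁻¹ : ℂ) • x

theorem mem_normalize (E : KotheSpace) {x : ℕ → ℂ} (hx : E.Mem x) : E.Mem (E.normalize x) :=
  E.mem_smul _ hx

theorem nrm_normalize_le (E : KotheSpace) {x : ℕ → ℂ} (hx : E.Mem x) :
    E.nrm (E.normalize x) ≤ 1 := by
  rw [normalize, E.nrm_smul _ hx, norm_inv, Complex.norm_real,
    Real.norm_of_nonneg (E.nrm_nonneg hx)]
  exact inv_mul_le_one

theorem nrm_mul_normalize (E : KotheSpace) {x : ℕ → ℂ} (hx : E.Mem x) (k : ℕ) :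
    (E.nrm x : ℂ) * E.normalize x k = x k := by
  by_cases h0 : E.nrm x = 0
  · rw [h0, (E.nrm_eq_zero_iff hx).1 h0]; simp
  · have : (E.nrm x : ℂ) ≠ 0 := by exact_mod_cast h0
    simp [normalize, mul_inv_cancel_left₀ this]

/-- A sequence in the unit ball is dominated, up to the weights `2⁻ᵐ`, by a single element. -/
theorem exists_mem_dominating (E : KotheSpace) {x : ℕ → ℕ → ℂ} (hx : ∀ m, E.Mem (x m))
    (hx1 : ∀ m, E.nrm (x m) ≤ 1) :
    ∃ g, E.Mem g ∧ ∀ m k, (1 / 2 : ℝ) ^ m * ‖x m k‖ ≤ ‖g k‖ := by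
  let a : ℕ → ℕ → ℂ := fun m k => (((1 / 2 : ℝ) ^ m * ‖x m k‖ : ℝ) : ℂ)
  have hax : ∀ m k, ‖a m k‖ = ‖((((1 / 2 : ℝ) ^ m : ℝ) : ℂ) • x m) k‖ := fun m k => by
    simp [a]
  have hsm : ∀ m, E.Mem ((((1 / 2 : ℝ) ^ m : ℝ) : ℂ) • x m) := fun m => E.mem_smul _ (hx m)
  have ha : ∀ m, E.Mem (a m) := fun m => E.normal_mem (hsm m) fun k => (hax m k).le
  have han : ∀ m, E.nrm (a m) ≤ (1 / 2 : ℝ) ^ m := fun m => by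
    refine (E.normal_nrm (ha m) (hsm m) fun k => (hax m k).le).trans ?_
    rw [E.nrm_smul _ (hx m), Complex.norm_real, Real.norm_of_nonneg (by positivity)]
    exact mul_le_of_le_one_right (by positivity) (hx1 m)
  let f : ℕ → ℕ → ℂ := fun n => ∑ m ∈ Finset.range n, a m
  have hf : ∀ n, E.Mem (f n) := E.mem_sum ha
  have hdiff : ∀ N d, E.nrm (f (N + d) - f N) ≤ 2 * (1 / 2 : ℝ) ^ N - 2 * (1 / 2 : ℝ) ^ (N + d) := by
    intro N d
    induction d with
    | zero => simpa using ((E.nrm_eq_zero_iff E.mem_zero).2 rfl).le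
    | succ d ih =>
      have he : f (N + (d + 1)) - f N = (f (N + d) - f N) + a (N + d) := by
        simp only [f, ← add_assoc, Finset.sum_range_succ]; abel
      rw [he]
      have h1 := E.nrm_add_le (E.mem_sub (hf (N + d)) (hf N)) (ha (N + d))
      have h2 := han (N + d)
      rw [← add_assoc, pow_succ]
      linarith
  have htail : ∀ N i, N ≤ i → E.nrm (f i - f N) ≤ 2 * (1 / 2 : ℝ) ^ N := fun N i hi => by
    obtain ⟨d, rfl⟩ := Nat.exists_eq_add_of_le hi
    have : (0 : ℝ) ≤ 2 * (1 / 2 : ℝ) ^ (N + d) := by positivity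
    linarith [hdiff N d]
  obtain ⟨g, hg, hlim⟩ := E.complete f hf fun ε hε => by
    obtain ⟨N, hN⟩ := exists_pow_lt_of_lt_one (show 0 < ε / 4 by positivity)
      (show (1 / 2 : ℝ) < 1 by norm_num)
    refine ⟨N, fun i hi j hj => ?_⟩
    have h1 := E.nrm_add_le (E.mem_sub (hf i) (hf N)) (E.mem_sub (hf N) (hf j))
    rw [sub_add_sub_cancel, E.nrm_sub_comm (hf N) (hf j)] at h1
    linarith [htail N i hi, htail N j hj]
  refine ⟨g, hg, fun m k => le_of_forall_pos_le_add fun ε hε => ?_⟩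
  obtain ⟨N, hN⟩ := hlim ε hε
  set i := max N (m + 1)
  have h1 : ‖f i k - g k‖ < ε :=
    (E.coord_le_nrm (E.mem_sub (hf i) hg) k).trans_lt (hN i (le_max_left _ _))
  have h2 : (1 / 2 : ℝ) ^ m * ‖x m k‖ ≤ ‖f i k‖ := by
    have : f i k = ((∑ l ∈ Finset.range i, (1 / 2 : ℝ) ^ l * ‖x l k‖ : ℝ) : ℂ) := by
      simp only [f, a, Finset.sum_apply, Complex.ofReal_sum]
    rw [this, Complex.norm_real, Real.norm_of_nonneg (by positivity)]
    exact Finset.single_le_sum (f := fun l => (1 / 2 : ℝ) ^ l * ‖x l k‖)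
      (fun l _ => by positivity)
      (Finset.mem_range.2 (Nat.lt_of_lt_of_le m.lt_succ_self (le_max_right _ _)))
  linarith [norm_sub_norm_le (f i k) (g k)]

theorem bddAbove_dualNrm (E : KotheSpace) {z : ℕ → ℂ} (hz : E.dualMem z) :
    BddAbove {r | ∃ x, E.Mem x ∧ E.nrm x ≤ 1 ∧ r = ∑' k, ‖z k * x k‖} := by
  by_contra hb
  have hex : ∀ m : ℕ, ∃ x, E.Mem x ∧ E.nrm x ≤ 1 ∧ (4 : ℝ) ^ m < ∑' k, ‖z k * x k‖ := fun m => by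
    obtain ⟨_, ⟨x, hx, hx1, rfl⟩, hlt⟩ := not_bddAbove_iff.1 hb ((4 : ℝ) ^ m)
    exact ⟨x, hx, hx1, hlt⟩
  choose x hx hx1 hlt using hex
  obtain ⟨g, hg, hdom⟩ := E.exists_mem_dominating hx hx1
  have hle : ∀ m : ℕ, (2 : ℝ) ^ m ≤ ∑' k, ‖z k * g k‖ := fun m => by
    calc (2 : ℝ) ^ m = (1 / 2 : ℝ) ^ m * 4 ^ m := by rw [← mul_pow]; norm_num
      _ ≤ (1 / 2 : ℝ) ^ m * ∑' k, ‖z k * x m k‖ := by gcongr; exact (hlt m).le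
      _ = ∑' k, (1 / 2 : ℝ) ^ m * ‖z k * x m k‖ := tsum_mul_left.symm
      _ ≤ ∑' k, ‖z k * g k‖ := by
        refine ((hz _ (hx m)).mul_left _).tsum_le_tsum (fun k => ?_) (hz _ hg)
        rw [norm_mul, norm_mul, mul_left_comm]
        exact mul_le_mul_of_nonneg_left (hdom m k) (norm_nonneg _)
  obtain ⟨m, hm⟩ := pow_unbounded_of_one_lt (∑' k, ‖z k * g k‖) (one_lt_two : (1 : ℝ) < 2)
  exact (hle m).not_gt hm

theorem dualNrm_nonneg (E : KotheSpace) (z : ℕ → ℂ) : 0 ≤ E.dualNrm z := by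
  refine Real.sSup_nonneg ?_
  rintro _ ⟨x, -, -, rfl⟩
  positivity

/-- Hölder's inequality for a Köthe space and its Köthe dual. -/
theorem tsum_norm_mul_le (E : KotheSpace) {z x : ℕ → ℂ} (hz : E.dualMem z) (hx : E.Mem x) :
    ∑' k, ‖z k * x k‖ ≤ E.nrm x * E.dualNrm z := by
  have hk : ∀ k, ‖z k * x k‖ = E.nrm x * ‖z k * E.normalize x k‖ := fun k => by
    rw [← E.nrm_mul_normalize hx k, mul_left_comm, norm_mul (E.nrm x : ℂ), Complex.norm_real,
      Real.norm_of_nonneg (E.nrm_nonneg hx)]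
  simp_rw [hk, tsum_mul_left]
  exact mul_le_mul_of_nonneg_left
    (le_csSup (E.bddAbove_dualNrm hz) ⟨_, E.mem_normalize hx, E.nrm_normalize_le hx, rfl⟩)
    (E.nrm_nonneg hx)

end KotheSpace

/-- **Density Lemma** (for the ideal of all bounded multilinear operators):
if the diagonal operator associated with `α` maps the unit ball of each finite-dimensional
truncation of `E` into the ball of radius `C` of `F`, then it maps `E × ⋯ × E` into
`F^{××}` with norm at most `C`. -/
theorem density_lemma (n : ℕ) (hn : 1 ≤ n) (E F : KotheSpace) (α : ℕ → ℂ) (C : ℝ) (hC : 0 ≤ C)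
    (h : ∀ N : ℕ, ∀ x : Fin n → ℕ → ℂ,
      (∀ i, E.Mem (x i) ∧ E.nrm (x i) ≤ 1 ∧ ∀ k, N < k → x i k = 0) →
      F.Mem (fun k => α k * ∏ i, x i k) ∧ F.nrm (fun k => α k * ∏ i, x i k) ≤ C) :
    ∀ x : Fin n → ℕ → ℂ, (∀ i, E.Mem (x i)) →
      F.bidualMem (fun k => α k * ∏ i, x i k) ∧
      F.bidualNrm (fun k => α k * ∏ i, x i k) ≤ C * ∏ i, E.nrm (x i) := by
  intro x hx
  have hP : 0 ≤ C * ∏ i, E.nrm (x i) :=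
    mul_nonneg hC (Finset.prod_nonneg fun i _ => E.nrm_nonneg (hx i))
  have hpartial : ∀ w, F.dualMem w → ∀ N, ∑ k ∈ Finset.range N, ‖(α k * ∏ i, x i k) * w k‖ ≤
      (C * ∏ i, E.nrm (x i)) * F.dualNrm w := by
    intro w hw N
    let u : Fin n → ℕ → ℂ := fun i k => if k ≤ N then E.normalize (x i) k else 0
    have hu : ∀ i k, ‖u i k‖ ≤ ‖E.normalize (x i) k‖ := fun i k => by
      simp only [u]; split_ifs <;> simp
    have hmem : ∀ i, E.Mem (u i) := fun i => E.normal_mem (E.mem_normalize (hx i)) (hu i)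
    obtain ⟨hy, hyC⟩ := h N u fun i => ⟨hmem i,
      (E.normal_nrm (hmem i) (E.mem_normalize (hx i)) (hu i)).trans (E.nrm_normalize_le (hx i)),
      fun k hk => if_neg hk.not_ge⟩
    have hk : ∀ k ∈ Finset.range N, ‖(α k * ∏ i, x i k) * w k‖ =
        (∏ i, E.nrm (x i)) * ‖w k * (α k * ∏ i, u i k)‖ := fun k hk => by
      have hxu : ∏ i, x i k = ((∏ i, E.nrm (x i) : ℝ) : ℂ) * ∏ i, u i k := by
        rw [Complex.ofReal_prod, ← Finset.prod_mul_distrib]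
        refine Finset.prod_congr rfl fun i _ => ?_
        simp only [u, if_pos (Finset.mem_range.1 hk).le, E.nrm_mul_normalize (hx i)]
      rw [hxu]
      simp only [norm_mul, Complex.norm_real,
        Real.norm_of_nonneg (Finset.prod_nonneg fun i _ => E.nrm_nonneg (hx i))]
      ring
    rw [Finset.sum_congr rfl hk, ← Finset.mul_sum, mul_comm C, mul_assoc]
    refine mul_le_mul_of_nonneg_left ?_ (Finset.prod_nonneg fun i _ => E.nrm_nonneg (hx i))
    calc ∑ k ∈ Finset.range N, ‖w k * (α k * ∏ i, u i k)‖
        ≤ ∑' k, ‖w k * (α k * ∏ i, u i k)‖ :=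
          (hw _ hy).sum_le_tsum _ fun _ _ => norm_nonneg _
      _ ≤ F.nrm (fun k => α k * ∏ i, u i k) * F.dualNrm w := F.tsum_norm_mul_le hw hy
      _ ≤ C * F.dualNrm w := mul_le_mul_of_nonneg_right hyC (F.dualNrm_nonneg w)
  refine ⟨fun w hw => summable_of_sum_range_le (fun _ => norm_nonneg _) (hpartial w hw),
    Real.sSup_le ?_ hP⟩
  rintro _ ⟨w, hw, hw1, rfl⟩
  exact (Real.tsum_le_of_sum_range_le (fun _ => norm_nonneg _) (hpartial w hw)).trans
    (mul_le_of_le_one_right hP hw1)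
end

section
/- Let n ≥ 1 and let E, F be Köthe sequence spaces such that E is n-convex with constant 1. Let α ∈ ℂ^ℕ and C ≥ 0. Then the following are equivalent: (a) α·x_1⋯x_n ∈ F and ‖α·x_1⋯x_n‖_F ≤ C·‖x_1‖_E⋯‖x_n‖_E for all x_1,…,x_n ∈ E; (b) the pointwise product α·x ∈ F and ‖α·x‖_F ≤ C·‖x‖_{E^n} for all x ∈ E^n. (This is the isometric identity ℓ_n(𝓛;E,F) = M(E^n,F).) -/
namespace KotheSpace

/-- `E` is `n`-convex with constant 1. -/
def NConvex (E : KotheSpace) (n : ℕ) : Prop :=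
  ∀ (m : ℕ) (x : Fin m → ℕ → ℂ), (∀ j, E.Mem (x j)) →
    E.Mem (fun k => (Complex.ofReal ((∑ j, ‖x j k‖ ^ n) ^ ((1 : ℝ) / n)))) ∧
    E.nrm (fun k => (Complex.ofReal ((∑ j, ‖x j k‖ ^ n) ^ ((1 : ℝ) / n)))) ≤
      (∑ j, E.nrm (x j) ^ n) ^ ((1 : ℝ) / n)

/-- Membership in the power `E^n` (for `E` `n`-convex): bounded sequences `x` with
`(|x(k)|^{1/n})_k ∈ E`. -/
def powMem (E : KotheSpace) (n : ℕ) (x : ℕ → ℂ) : Prop :=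
  (∃ M : ℝ, ∀ k, ‖x k‖ ≤ M) ∧ E.Mem (fun k => Complex.ofReal (‖x k‖ ^ ((1 : ℝ) / n)))

/-- The norm of the power `E^n`: `‖x‖_{E^n} = ‖(|x(k)|^{1/n})_k‖_E ^ n`. -/
noncomputable def powNrm (E : KotheSpace) (n : ℕ) (x : ℕ → ℂ) : ℝ :=
  E.nrm (fun k => Complex.ofReal (‖x k‖ ^ ((1 : ℝ) / n))) ^ n

end KotheSpace

open scoped BigOperators

namespace KotheSpace

theorem nrm_zero (E : KotheSpace) : E.nrm 0 = 0 :=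
  (E.nrm_eq_zero_iff E.mem_zero).2 rfl

theorem mem_congr_norm (E : KotheSpace) {x y : ℕ → ℂ} (hy : E.Mem y)
    (h : ∀ k, ‖x k‖ = ‖y k‖) : E.Mem x ∧ E.nrm x = E.nrm y := by
  have hx : E.Mem x := E.normal_mem hy fun k => (h k).le
  exact ⟨hx, le_antisymm (E.normal_nrm hx hy fun k => (h k).le)
    (E.normal_nrm hy hx fun k => (h k).ge)⟩

theorem sum_mem_and_nrm_sum_le (E : KotheSpace) {ι : Type*} (s : Finset ι) (x : ι → ℕ → ℂ)
    (hx : ∀ i, E.Mem (x i)) :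
    E.Mem (∑ i ∈ s, x i) ∧ E.nrm (∑ i ∈ s, x i) ≤ ∑ i ∈ s, E.nrm (x i) := by
  classical
  induction s using Finset.induction_on with
  | empty => simpa using ⟨E.mem_zero, E.nrm_zero.le⟩
  | insert a s ha ih =>
    rw [Finset.sum_insert ha, Finset.sum_insert ha]
    exact ⟨E.mem_add (hx a) ih.1, (E.nrm_add_le (hx a) ih.1).trans (by linarith [ih.2])⟩

/-- The pointwise product of `n` elements of `E` lies in `E^n`, with the expected norm bound. -/
theorem powMem_prod_and_powNrm_prod_le (E : KotheSpace) {n : ℕ} (hn : n ≠ 0)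
    (x : Fin n → ℕ → ℂ) (hx : ∀ i, E.Mem (x i)) (hpos : ∀ i, 0 < E.nrm (x i)) :
    E.powMem n (fun k => ∏ i, x i k) ∧
      E.powNrm n (fun k => ∏ i, x i k) ≤ ∏ i, E.nrm (x i) := by
  have hn' : (0 : ℝ) < n := by positivity
  have hP : 0 < ∏ i, E.nrm (x i) := Finset.prod_pos fun i _ => hpos i
  set N : ℝ := (∏ i, E.nrm (x i)) ^ ((1 : ℝ) / n) with hN
  have hN0 : 0 < N := Real.rpow_pos_of_pos hP _
  have habs : ∀ i, E.Mem (fun k => (‖x i k‖ : ℂ)) ∧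
      E.nrm (fun k => (‖x i k‖ : ℂ)) = E.nrm (x i) := fun i =>
    E.mem_congr_norm (hx i) fun k => by simp
  let c : Fin n → ℝ := fun i => N * (1 / n * (E.nrm (x i))⁻¹)
  have hc : ∀ i, 0 ≤ c i := fun i => by have := hpos i; positivity
  have hmem : ∀ i, E.Mem ((c i : ℂ) • fun k => (‖x i k‖ : ℂ)) := fun i =>
    E.mem_smul _ (habs i).1
  have hnrm : ∀ i, E.nrm ((c i : ℂ) • fun k => (‖x i k‖ : ℂ)) = N / n := fun i => by
    rw [E.nrm_smul _ (habs i).1, (habs i).2, Complex.norm_real, Real.norm_of_nonneg (hc i)]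
    have := (hpos i).ne'
    simp only [c]
    field_simp
  obtain ⟨hz, hzN⟩ := E.sum_mem_and_nrm_sum_le Finset.univ _ hmem
  have hle : ∀ k, ‖Complex.ofReal (‖∏ i, x i k‖ ^ ((1 : ℝ) / n))‖ ≤
      ‖(∑ i, (c i : ℂ) • fun k => (‖x i k‖ : ℂ)) k‖ := fun k => by
    have hsum : (∑ i, (c i : ℂ) • fun k => (‖x i k‖ : ℂ)) k =
        ((∑ i, c i * ‖x i k‖ : ℝ) : ℂ) := by simp
    have hamgm := Real.geom_mean_le_arith_mean_weighted Finset.univ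
      (fun _ : Fin n => (1 : ℝ) / n) (fun i => ‖x i k‖ / E.nrm (x i))
      (fun _ _ => by positivity) (by simp [hn'.ne'])
      (fun i _ => div_nonneg (norm_nonneg _) (hpos i).le)
    rw [Real.finsetProd_rpow _ _ (fun i _ => div_nonneg (norm_nonneg _) (hpos i).le),
      Finset.prod_div_distrib, Real.div_rpow (Finset.prod_nonneg fun _ _ => norm_nonneg _) hP.le,
      ← hN, div_le_iff₀ hN0, Finset.sum_mul] at hamgm
    rw [hsum, Complex.norm_real, Complex.norm_real, Real.norm_of_nonneg (by positivity),
      Real.norm_of_nonneg (Finset.sum_nonneg fun i _ => mul_nonneg (hc i) (norm_nonneg _)),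
      norm_prod]
    refine hamgm.trans_eq (Finset.sum_congr rfl fun i _ => ?_)
    simp only [c]
    ring
  have hg := E.normal_mem hz hle
  refine ⟨⟨⟨∏ i, E.nrm (x i), fun k => ?_⟩, hg⟩, ?_⟩
  · rw [norm_prod]
    exact Finset.prod_le_prod (fun _ _ => norm_nonneg _) fun i _ => E.coord_le_nrm (hx i) k
  · have hgN := (E.normal_nrm hg hz hle).trans hzN
    simp only [hnrm, Finset.sum_const, Finset.card_univ, Fintype.card_fin, nsmul_eq_mul,
      mul_div_cancel₀ _ hn'.ne'] at hgN
    calc E.powNrm n (fun k => ∏ i, x i k) ≤ N ^ n := pow_le_pow_left₀ (E.nrm_nonneg hg) hgN n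
      _ = ∏ i, E.nrm (x i) := by rw [hN, one_div, Real.rpow_inv_natCast_pow hP.le hn]

end KotheSpace

/-- The isometric identity `ℓ_n(𝓛; E, F) = M(E^n, F)` for `E` `n`-convex with constant 1:
the diagonal `n`-linear operator associated with `α` maps `E × ⋯ × E` into `F` with norm
bound `C` iff `α` is a multiplier from `E^n` into `F` with bound `C`. -/
theorem diag_eq_multiplier_pow (n : ℕ) (hn : 1 ≤ n) (E F : KotheSpace) (hE : E.NConvex n)
    (α : ℕ → ℂ) (C : ℝ) (hC : 0 ≤ C) :
    (∀ x : Fin n → ℕ → ℂ, (∀ i, E.Mem (x i)) →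
        F.Mem (fun k => α k * ∏ i, x i k) ∧
        F.nrm (fun k => α k * ∏ i, x i k) ≤ C * ∏ i, E.nrm (x i)) ↔
      (∀ x : ℕ → ℂ, E.powMem n x →
        F.Mem (fun k => α k * x k) ∧ F.nrm (fun k => α k * x k) ≤ C * E.powNrm n x) := by
  have hn0 : n ≠ 0 := by omega
  constructor
  · rintro h x ⟨-, hx⟩
    obtain ⟨hm, hb⟩ := h (fun _ k => Complex.ofReal (‖x k‖ ^ ((1 : ℝ) / n))) fun _ => hx
    obtain ⟨hm', he⟩ := F.mem_congr_norm (x := fun k => α k * x k) hm fun k => by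
      simp only [Finset.prod_const, Finset.card_univ, Fintype.card_fin]
      rw [← Complex.ofReal_pow, one_div, Real.rpow_inv_natCast_pow (norm_nonneg _) hn0]
      simp
    refine ⟨hm', he.trans_le (hb.trans_eq ?_)⟩
    simp [KotheSpace.powNrm]
  · intro h x hx
    by_cases h0 : ∃ i, E.nrm (x i) = 0
    · obtain ⟨i, hi⟩ := h0
      have hxi : x i = 0 := (E.nrm_eq_zero_iff (hx i)).1 hi
      have hz : (fun k => α k * ∏ i, x i k) = 0 := by
        funext k
        have hk : ∏ i, x i k = 0 := Finset.prod_eq_zero (Finset.mem_univ i) (congrFun hxi k)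
        simp [hk]
      rw [hz, Finset.prod_eq_zero (Finset.mem_univ i) hi, F.nrm_zero, mul_zero]
      exact ⟨F.mem_zero, le_rfl⟩
    · push Not at h0
      obtain ⟨hm, hb⟩ := E.powMem_prod_and_powNrm_prod_le hn0 x hx fun i =>
        (E.nrm_nonneg (hx i)).lt_of_ne' (h0 i)
      obtain ⟨hF, hFb⟩ := h _ hm
      exact ⟨hF, hFb.trans (mul_le_mul_of_nonneg_left hb hC)⟩
end

section
/- Let 1 ≤ p < q < ∞ and let w = (w(k))_k be a decreasing sequence of positive reals with w(1) = 1, w(k) → 0 and ∑_k w(k) = ∞. Then for every α ∈ ℂ^ℕ one has the equality in [0,∞]: sup{Λ_{w,p}(α·β) : β ∈ ℓ_q, ‖β‖_{ℓ_q} ≤ 1} = Λ_{w',p'}(α), where w'(k) = w(k)^{q/(q-p)}, p' = pq/(q-p), and α·β is the pointwise product sequence k ↦ α(k)·β(k). In particular the space of multipliers from ℓ_q into the Lorentz sequence space d(w,p) is exactly {α : Λ_{w',p'}(α) < ∞}, with the multiplier norm equal to Λ_{w',p'}. -/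
open scoped BigOperators ENNReal

/-- The (extended-real valued) Lorentz norm `Λ_{w,s}(x) = sup_σ (∑_k |x(σ(k))|^s · w(k))^{1/s}`,
the supremum running over all permutations of `ℕ`.  The Lorentz sequence space `d(w,s)`
consists of the sequences where this quantity is finite. -/
noncomputable def lorentzNorm (w : ℕ → ℝ) (s : ℝ) (x : ℕ → ℂ) : ℝ≥0∞ :=
  ⨆ σ : Equiv.Perm ℕ, (∑' k, ENNReal.ofReal (‖x (σ k)‖ ^ s * w k)) ^ (1 / s)

/-- Hölder's inequality for series in `[0, ∞]`. -/
lemma ENNReal.tsum_mul_le_Lp_mul_Lq {p q : ℝ} (hpq : p.HolderConjugate q) (f g : ℕ → ℝ≥0∞) :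
    ∑' k, f k * g k ≤ (∑' k, f k ^ p) ^ (1 / p) * (∑' k, g k ^ q) ^ (1 / q) := by
  simpa [MeasureTheory.lintegral_count] using
    ENNReal.lintegral_mul_le_Lp_mul_Lq MeasureTheory.Measure.count hpq
      (f := f) (g := g) (measurable_of_countable f).aemeasurable
      (measurable_of_countable g).aemeasurable

/-- The general term of the Lorentz norm with weight `v ^ (q / (q - p))` and exponent
`p * q / (q - p)` is a power of the general term with weight `v` and exponent `p`. -/
lemma rpow_mul_rpow_eq_rpow_conjExponent {p q x v : ℝ} (hx : 0 ≤ x) (hv : 0 ≤ v) :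
    x ^ (p * q / (q - p)) * v ^ (q / (q - p)) = (x ^ p * v) ^ (q / (q - p)) := by
  rw [Real.mul_rpow (Real.rpow_nonneg hx p) hv, ← Real.rpow_mul hx, mul_div_assoc]

lemma holderConjugate_div_sub {p q : ℝ} (hp : 0 < p) (hpq : p < q) :
    (q / (q - p)).HolderConjugate (q / p) := by
  have hqp : 0 < q - p := sub_pos.2 hpq
  have hq : 0 < q := hp.trans hpq
  rw [Real.holderConjugate_iff]
  refine ⟨(one_lt_div hqp).2 (by linarith), ?_⟩
  field_simp
  ring

/-- Multiplication by `α` maps the unit ball of `ℓ_q` into the ball of `d(w,p)` whose radius is the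
Lorentz norm of `α` with weight `w ^ (q / (q - p))` and exponent `p * q / (q - p)`. -/
lemma lorentzNorm_mul_le {p q : ℝ} (hp : 0 < p) (hpq : p < q) {w : ℕ → ℝ}
    (hw : ∀ k, 0 ≤ w k) (α β : ℕ → ℂ) (hβ : Summable (fun k => ‖β k‖ ^ q))
    (hβ_le : (∑' k, ‖β k‖ ^ q) ^ (1 / q) ≤ 1) :
    lorentzNorm w p (fun k => α k * β k) ≤
      lorentzNorm (fun k => w k ^ (q / (q - p))) (p * q / (q - p)) α := by
  have hqp : 0 < q - p := sub_pos.2 hpq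
  have hq : 0 < q := hp.trans hpq
  have hβ_nonneg : ∀ k, 0 ≤ ‖β k‖ ^ q := fun k => Real.rpow_nonneg (norm_nonneg _) _
  have hsum_le : ∑' k, ‖β k‖ ^ q ≤ 1 := by
    by_contra! h
    exact (Real.one_lt_rpow h (by positivity : 0 < 1 / q)).not_ge hβ_le
  refine iSup_mono fun σ => ?_
  have hβ_tsum : ∑' k, ENNReal.ofReal (‖β (σ k)‖ ^ p) ^ (q / p) ≤ 1 := by
    calc ∑' k, ENNReal.ofReal (‖β (σ k)‖ ^ p) ^ (q / p)
        = ∑' k, ENNReal.ofReal (‖β (σ k)‖ ^ q) := by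
          refine tsum_congr fun k => ?_
          rw [ENNReal.ofReal_rpow_of_nonneg (by positivity) (by positivity),
            ← Real.rpow_mul (norm_nonneg _), mul_div_cancel₀ _ hp.ne']
      _ = ∑' k, ENNReal.ofReal (‖β k‖ ^ q) :=
          σ.tsum_eq (fun k => ENNReal.ofReal (‖β k‖ ^ q))
      _ = ENNReal.ofReal (∑' k, ‖β k‖ ^ q) :=
          (ENNReal.ofReal_tsum_of_nonneg hβ_nonneg hβ).symm
      _ ≤ 1 := by simpa using hsum_le
  have hexp : 1 / (p * q / (q - p)) = 1 / (q / (q - p)) * (1 / p) := by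
    field_simp
  rw [hexp, ENNReal.rpow_mul]
  refine ENNReal.rpow_le_rpow ?_ (by positivity)
  calc ∑' k, ENNReal.ofReal (‖α (σ k) * β (σ k)‖ ^ p * w k)
      = ∑' k, ENNReal.ofReal (‖α (σ k)‖ ^ p * w k) * ENNReal.ofReal (‖β (σ k)‖ ^ p) := by
        refine tsum_congr fun k => ?_
        have := hw k
        rw [← ENNReal.ofReal_mul (by positivity), norm_mul,
          Real.mul_rpow (norm_nonneg _) (norm_nonneg _)]
        ring_nf
    _ ≤ (∑' k, ENNReal.ofReal (‖α (σ k)‖ ^ p * w k) ^ (q / (q - p))) ^ (1 / (q / (q - p))) *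
          (∑' k, ENNReal.ofReal (‖β (σ k)‖ ^ p) ^ (q / p)) ^ (1 / (q / p)) :=
        ENNReal.tsum_mul_le_Lp_mul_Lq (holderConjugate_div_sub hp hpq) _ _
    _ ≤ (∑' k, ENNReal.ofReal (‖α (σ k)‖ ^ p * w k) ^ (q / (q - p))) ^ (1 / (q / (q - p))) *
          1 := by
        gcongr
        exact ENNReal.rpow_le_one hβ_tsum (by positivity)
    _ = (∑' k, ENNReal.ofReal (‖α (σ k)‖ ^ (p * q / (q - p)) * w k ^ (q / (q - p)))) ^
          (1 / (q / (q - p))) := by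
        rw [mul_one]
        congr 1
        refine tsum_congr fun k => ?_
        have := hw k
        rw [rpow_mul_rpow_eq_rpow_conjExponent (norm_nonneg _) (hw k),
          ENNReal.ofReal_rpow_of_nonneg (by positivity) (by positivity)]

/-- Finitely supported sequences in the unit ball of `ℓ_q` realize equality in Hölder's inequality
along any finite set of indices. -/
lemma exists_lorentzNorm_mul_ge {p q : ℝ} (hp : 0 < p) (hpq : p < q) {w : ℕ → ℝ}
    (hw : ∀ k, 0 ≤ w k) (α : ℕ → ℂ) (σ : Equiv.Perm ℕ) (s : Finset ℕ) :
    ∃ β : ℕ → ℂ, (Summable (fun k => ‖β k‖ ^ q) ∧ (∑' k, ‖β k‖ ^ q) ^ (1 / q) ≤ 1) ∧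
      (∑ k ∈ s, ENNReal.ofReal (‖α (σ k)‖ ^ (p * q / (q - p)) * w k ^ (q / (q - p)))) ^
        (1 / (p * q / (q - p))) ≤ lorentzNorm w p (fun k => α k * β k) := by
  have hqp : 0 < q - p := sub_pos.2 hpq
  have hq : 0 < q := hp.trans hpq
  set A : ℕ → ℝ := fun k => ‖α (σ k)‖ ^ p * w k
  have hA0 : ∀ k, 0 ≤ A k := fun k => mul_nonneg (by positivity) (hw k)
  have hAr0 : ∀ k, 0 ≤ A k ^ (q / (q - p)) := fun k => Real.rpow_nonneg (hA0 k) _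
  set S : ℝ := ∑ k ∈ s, A k ^ (q / (q - p)) with hS
  have hS0 : 0 ≤ S := Finset.sum_nonneg fun k _ => hAr0 k
  have hsum : ∑ k ∈ s, ENNReal.ofReal (‖α (σ k)‖ ^ (p * q / (q - p)) * w k ^ (q / (q - p))) =
      ENNReal.ofReal S := by
    rw [hS, ENNReal.ofReal_sum_of_nonneg fun k _ => hAr0 k]
    exact Finset.sum_congr rfl fun k _ => by
      rw [rpow_mul_rpow_eq_rpow_conjExponent (norm_nonneg _) (hw k)]
  rw [hsum]
  rcases hS0.eq_or_lt with hS_zero | hS_pos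
  · refine ⟨0, ?_, ?_⟩
    · simp [Real.zero_rpow hq.ne', Real.zero_rpow (inv_ne_zero hq.ne'), summable_zero]
    · rw [← hS_zero, ENNReal.ofReal_zero, ENNReal.zero_rpow_of_pos (by positivity)]
      exact zero_le
  set b : ℕ → ℝ := fun k => if k ∈ s then A k ^ (q / (q - p)) / S else 0 with hb
  have hb0 : ∀ k, 0 ≤ b k := fun k => by
    simp only [hb]
    split_ifs
    exacts [div_nonneg (hAr0 k) hS0, le_rfl]
  have hnorm : ∀ k, ‖(((b k) ^ (1 / q) : ℝ) : ℂ)‖ = b k ^ (1 / q) := fun k => by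
    rw [Complex.norm_real, Real.norm_of_nonneg (Real.rpow_nonneg (hb0 k) _)]
  have hb_sum : HasSum b 1 := by
    have h : ∑ k ∈ s, b k = 1 := by
      rw [Finset.sum_congr rfl fun k hk => if_pos hk, ← Finset.sum_div, ← hS,
        div_self hS_pos.ne']
    rw [← h]
    exact hasSum_sum_of_ne_finset_zero fun k hk => if_neg hk
  have hβ_sum : HasSum (fun k => ‖(((b (σ.symm k)) ^ (1 / q) : ℝ) : ℂ)‖ ^ q) 1 := by
    have h : (fun k => ‖(((b (σ.symm k)) ^ (1 / q) : ℝ) : ℂ)‖ ^ q) = b ∘ σ.symm := by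
      funext k
      rw [hnorm, ← Real.rpow_mul (hb0 _), one_div_mul_cancel hq.ne', Real.rpow_one,
        Function.comp_apply]
    rw [h]
    exact σ.symm.hasSum_iff.2 hb_sum
  refine ⟨fun k => ((b (σ.symm k) ^ (1 / q) : ℝ) : ℂ), ⟨hβ_sum.summable, ?_⟩, ?_⟩
  · rw [hβ_sum.tsum_eq, Real.one_rpow]
  have hterm : ∀ k ∈ s, A k * b k ^ (p / q) = A k ^ (q / (q - p)) / S ^ (p / q) := by
    intro k hk
    have hexp : 1 + q / (q - p) * (p / q) = q / (q - p) := by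
      field_simp
      ring
    have hbk : b k = A k ^ (q / (q - p)) / S := if_pos hk
    rw [hbk, Real.div_rpow (hAr0 k) hS0, ← Real.rpow_mul (hA0 k), ← mul_div_assoc]
    nth_rewrite 1 [← Real.rpow_one (A k)]
    rw [← Real.rpow_add_of_nonneg (hA0 k) zero_le_one (by positivity), hexp]
  have htotal : ∑ k ∈ s, A k * b k ^ (p / q) = S ^ ((q - p) / q) := by
    rw [Finset.sum_congr rfl hterm, ← Finset.sum_div, ← hS]
    nth_rewrite 1 [← Real.rpow_one S]
    rw [← Real.rpow_sub hS_pos, sub_div, div_self hq.ne']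
  have hexp : 1 / (p * q / (q - p)) = (q - p) / q * (1 / p) := by
    field_simp
  refine le_trans ?_ (le_iSup _ σ)
  rw [hexp, ENNReal.rpow_mul]
  refine ENNReal.rpow_le_rpow ?_ (by positivity)
  rw [ENNReal.ofReal_rpow_of_nonneg hS0 (by positivity), ← htotal,
    ENNReal.ofReal_sum_of_nonneg fun k _ => mul_nonneg (hA0 k) (Real.rpow_nonneg (hb0 k) _)]
  refine le_trans (Finset.sum_le_sum fun k _ => ?_) (ENNReal.sum_le_tsum s)
  beta_reduce
  rw [norm_mul, σ.symm_apply_apply, hnorm, Real.mul_rpow (norm_nonneg _)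
    (Real.rpow_nonneg (hb0 k) _), ← Real.rpow_mul (hb0 k), one_div_mul_eq_div, mul_right_comm]

/-- The multiplier norm of `α` from `ℓ_q` into the Lorentz space `d(w,p)` (for `1 ≤ p < q`)
equals the Lorentz norm `Λ_{w',p'}(α)` with `w' = w^{q/(q-p)}` and `p' = pq/(q-p)`.
In particular the space of multipliers from `ℓ_q` into `d(w,p)` is
`d(w^{q/(q-p)}, pq/(q-p))` isometrically. -/
theorem multiplier_lq_lorentz (p q : ℝ) (hp : 1 ≤ p) (hpq : p < q)
    (w : ℕ → ℝ) (hw_pos : ∀ k, 0 < w k) (hw_anti : Antitone w) (hw_one : w 0 = 1)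
    (hw_lim : Filter.Tendsto w Filter.atTop (nhds 0)) (hw_div : ¬ Summable w)
    (α : ℕ → ℂ) :
    (⨆ (β : ℕ → ℂ) (_ : Summable (fun k => ‖β k‖ ^ q) ∧ (∑' k, ‖β k‖ ^ q) ^ (1 / q) ≤ 1),
        lorentzNorm w p (fun k => α k * β k)) =
      lorentzNorm (fun k => w k ^ (q / (q - p))) (p * q / (q - p)) α := by
  have hp0 : 0 < p := by linarith
  have hqp : 0 < q - p := sub_pos.2 hpq
  have hq : 0 < q := hp0.trans hpq
  have hw : ∀ k, 0 ≤ w k := fun k => (hw_pos k).le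
  refine le_antisymm (iSup₂_le fun β hβ => lorentzNorm_mul_le hp0 hpq hw α β hβ.1 hβ.2)
    (iSup_le fun σ => ?_)
  have hexp : 0 < p * q / (q - p) := by positivity
  rw [one_div, ENNReal.rpow_inv_le_iff hexp, ENNReal.tsum_eq_iSup_sum]
  refine iSup_le fun s => ?_
  rw [← ENNReal.rpow_inv_le_iff hexp, ← one_div]
  obtain ⟨β, hβ, hle⟩ := exists_lorentzNorm_mul_ge hp0 hpq hw α σ s
  exact hle.trans (le_iSup₂_of_le β hβ le_rfl)
end

section
/- Let n ≥ 1, let 1 ≤ p < q < ∞ and define r by 1/r = 1/p − 1/q. Let E be a Köthe sequence space such that (|x(k)|^n)_k ∈ E for every x ∈ ℓ_p. Then for every α ∈ ℓ_q and all x_1,…,x_n ∈ ℓ_r, the sequence k ↦ |α(k)|^n·x_1(k)⋯x_n(k) belongs to E. (That is, ℓ_q is contained in the 1/n-convexification of the Köthe sequence space ℓ_n(𝓛;ℓ_r,E).) -/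
open scoped BigOperators

/-- Hölder: if `1/r = 1/p - 1/q`, the product of an `ℓ_q` and an `ℓ_r` sequence lies in `ℓ_p`. -/
theorem summable_mul_rpow_of_one_div_eq_sub {ι : Type*} {p q r : ℝ} (hp : 0 < p) (hpq : p < q)
    (hr : 1 / r = 1 / p - 1 / q) {a b : ι → ℝ} (ha : ∀ k, 0 ≤ a k) (hb : ∀ k, 0 ≤ b k)
    (hsa : Summable fun k => a k ^ q) (hsb : Summable fun k => b k ^ r) :
    Summable fun k => (a k * b k) ^ p := by
  have hq : 0 < q := hp.trans hpq
  have hr0 : 0 < r := by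
    rw [← one_div_pos, hr, sub_pos]
    exact one_div_lt_one_div_of_lt hp hpq
  have hconj : (q / p).HolderConjugate (r / p) := by
    rw [Real.holderConjugate_iff]
    refine ⟨(one_lt_div hp).2 hpq, ?_⟩
    have h : p * (1 / r) = 1 - p / q := by rw [hr]; field_simp
    rw [inv_div, inv_div]
    linarith [mul_one_div p r]
  have hexp (s : ℝ) {c : ℝ} (hc : 0 ≤ c) : (c ^ p) ^ (s / p) = c ^ s := by
    rw [← Real.rpow_mul hc, mul_div_cancel₀ _ hp.ne']
  refine Summable.of_nonneg_of_le (fun k => Real.rpow_nonneg (mul_nonneg (ha k) (hb k)) p)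
    (fun k => ?_) ((hsa.div_const (q / p)).add (hsb.div_const (r / p)))
  rw [Real.mul_rpow (ha k) (hb k), ← hexp q (ha k), ← hexp r (hb k)]
  exact Real.young_inequality_of_nonneg (Real.rpow_nonneg (ha k) p)
    (Real.rpow_nonneg (hb k) p) hconj

/-- For `1 ≤ p < q`, `1/r = 1/p - 1/q` and `E` a Köthe sequence space with
`ℓ_p ⊆ E^{1/n}` (i.e. `(|x(k)|^n)_k ∈ E` for every `x ∈ ℓ_p`), one has
`ℓ_q ⊆ [ℓ_n(𝓛;ℓ_r,E)]^{1/n}`: for every `α ∈ ℓ_q` and `x_1,…,x_n ∈ ℓ_r` the sequence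
`k ↦ |α(k)|^n·x_1(k)⋯x_n(k)` belongs to `E`. -/
theorem lq_subset_conv (n : ℕ) (hn : 1 ≤ n) (p q r : ℝ) (hp : 1 ≤ p) (hpq : p < q)
    (hr : 1 / r = 1 / p - 1 / q) (E : KotheSpace)
    (hE : ∀ x : ℕ → ℂ, Summable (fun k => ‖x k‖ ^ p) →
      E.Mem (fun k => Complex.ofReal (‖x k‖ ^ n)))
    (α : ℕ → ℂ) (hα : Summable fun k => ‖α k‖ ^ q)
    (x : Fin n → ℕ → ℂ) (hx : ∀ i, Summable fun k => ‖x i k‖ ^ r) :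
    E.Mem (fun k => Complex.ofReal (‖α k‖ ^ n) * ∏ i, x i k) := by
  have hp0 : 0 < p := one_pos.trans_le hp
  have hr0 : 0 < r := by
    rw [← one_div_pos, hr, sub_pos]
    exact one_div_lt_one_div_of_lt hp0 hpq
  set t : ℕ → ℝ := fun k => (∑ i, ‖x i k‖ ^ r) ^ (1 / r) with ht
  have hsum0 (k : ℕ) : 0 ≤ ∑ i, ‖x i k‖ ^ r :=
    Finset.sum_nonneg fun i _ => Real.rpow_nonneg (norm_nonneg _) r
  have ht0 (k : ℕ) : 0 ≤ t k := Real.rpow_nonneg (hsum0 k) _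
  have htr (k : ℕ) : t k ^ r = ∑ i, ‖x i k‖ ^ r := by
    rw [ht, ← Real.rpow_mul (hsum0 k), one_div_mul_cancel hr0.ne', Real.rpow_one]
  have hxt (i : Fin n) (k : ℕ) : ‖x i k‖ ≤ t k := by
    rw [← Real.rpow_le_rpow_iff (norm_nonneg _) (ht0 k) hr0, htr]
    exact Finset.single_le_sum (f := fun i => ‖x i k‖ ^ r)
      (fun i _ => Real.rpow_nonneg (norm_nonneg _) r) (Finset.mem_univ i)
  have hst : Summable fun k => t k ^ r := by
    simp only [htr]
    exact summable_sum fun i _ => hx i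
  have hnorm (k : ℕ) : ‖(Complex.ofReal (‖α k‖ * t k))‖ = ‖α k‖ * t k := by
    rw [Complex.norm_real, Real.norm_of_nonneg (mul_nonneg (norm_nonneg _) (ht0 k))]
  refine E.normal_mem (hE (fun k => Complex.ofReal (‖α k‖ * t k)) ?_) fun k => ?_
  · simp only [hnorm]
    exact summable_mul_rpow_of_one_div_eq_sub hp0 hpq hr (fun k => norm_nonneg _) ht0 hα hst
  · rw [hnorm, norm_mul, norm_prod, Complex.norm_real, Complex.norm_real, norm_pow, norm_norm,
      Real.norm_of_nonneg (pow_nonneg (mul_nonneg (norm_nonneg _) (ht0 k)) n), mul_pow]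
    gcongr
    calc ∏ i, ‖x i k‖ ≤ ∏ _i : Fin n, t k :=
          Finset.prod_le_prod (fun i _ => norm_nonneg _) fun i _ => hxt i k
      _ = t k ^ n := by simp
end

section
/- Let n ≥ 1, let 1 ≤ p < q < ∞ and define r by 1/r = 1/p − 1/q. Let E be a Köthe sequence space such that (|x(k)|^n)_k ∈ E for every x ∈ ℓ_p, and set G = ℓ_n(𝓛;ℓ_r,E). Let X_1,…,X_n, Y_1,…,Y_n, Y be Banach spaces, let T : Y_1 × ⋯ × Y_n → Y be a bounded n-linear map satisfying the (G,q)-summing inequality with constant C, and for each j = 1,…,n let A_j : X_j → Y_j be a bounded linear operator that is absolutely r-summing with constant ρ_j, i.e., (∑_{i=1}^m ‖A_j x_i‖^r)^{1/r} ≤ ρ_j·w_r((x_i)_{i=1}^m) for every finite family (x_i)_{i=1}^m ⊆ X_j. Then the n-linear map T∘(A_1,…,A_n) : X_1 × ⋯ × X_n → Y satisfies the (E,p)-summing inequality with constant C·ρ_1⋯ρ_n. -/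
open scoped BigOperators

/-- The weak `ℓ_p` norm of a finite family in a Banach space:
`w_p(x) = sup{(∑_i ‖x'(x_i)‖^p)^{1/p} : x' ∈ X', ‖x'‖ ≤ 1}`. -/
noncomputable def weakLp (p : ℝ) {X : Type*} [NormedAddCommGroup X] [NormedSpace ℂ X]
    {m : ℕ} (x : Fin m → X) : ℝ :=
  sSup {r | ∃ f : X →L[ℂ] ℂ, ‖f‖ ≤ 1 ∧ r = (∑ i, ‖f (x i)‖ ^ p) ^ (1 / p)}

/-- A bounded `n`-linear map `T` satisfies the `(H,p)`-summing inequality with constant `C`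
(where `H` is given by a membership predicate `HMem` and a norm `Hnrm` on `ℂ^ℕ`):
for all finite families the finitely supported sequence `i ↦ ‖T(x_{1,i},…,x_{n,i})‖`
belongs to `H` with `H`-norm at most `C·w_p(x_1)⋯w_p(x_n)`. -/
def SummingIneq (HMem : (ℕ → ℂ) → Prop) (Hnrm : (ℕ → ℂ) → ℝ) (p : ℝ) {n : ℕ}
    {X : Fin n → Type*} [∀ j, NormedAddCommGroup (X j)] [∀ j, NormedSpace ℂ (X j)]
    {Y : Type*} [NormedAddCommGroup Y] [NormedSpace ℂ Y]
    (T : ContinuousMultilinearMap ℂ X Y) (C : ℝ) : Prop :=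
  ∀ (m : ℕ) (x : ∀ j, Fin m → X j),
    HMem (fun i => if h : i < m then Complex.ofReal ‖T (fun j => x j ⟨i, h⟩)‖ else 0) ∧
    Hnrm (fun i => if h : i < m then Complex.ofReal ‖T (fun j => x j ⟨i, h⟩)‖ else 0) ≤
      C * ∏ j, weakLp p (x j)

/-- The `(H,p)`-summing inequality with constant `C` for a linear operator. -/
def SummingIneqLin (HMem : (ℕ → ℂ) → Prop) (Hnrm : (ℕ → ℂ) → ℝ) (p : ℝ)
    {X Y : Type*} [NormedAddCommGroup X] [NormedSpace ℂ X]
    [NormedAddCommGroup Y] [NormedSpace ℂ Y] (A : X →L[ℂ] Y) (C : ℝ) : Prop :=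
  ∀ (m : ℕ) (x : Fin m → X),
    HMem (fun i => if h : i < m then Complex.ofReal ‖A (x ⟨i, h⟩)‖ else 0) ∧
    Hnrm (fun i => if h : i < m then Complex.ofReal ‖A (x ⟨i, h⟩)‖ else 0) ≤ C * weakLp p x

/-- Membership in the Köthe sequence space `ℓ_n(𝓛; ℓ_r, E)` of diagonal bounded `n`-linear
operators from `ℓ_r` into `E`: bounded sequences `α` with `α·z_1⋯z_n ∈ E` for all
`z_1,…,z_n ∈ ℓ_r`. -/
def lnLMem (n : ℕ) (r : ℝ) (E : KotheSpace) (α : ℕ → ℂ) : Prop :=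
  (∃ M : ℝ, ∀ k, ‖α k‖ ≤ M) ∧
  ∀ z : Fin n → ℕ → ℂ, (∀ i, Summable fun k => ‖z i k‖ ^ r) →
    E.Mem fun k => α k * ∏ i, z i k

/-- The norm of `ℓ_n(𝓛; ℓ_r, E)`:
`‖α‖ = sup{‖α·z_1⋯z_n‖_E : ‖z_j‖_{ℓ_r} ≤ 1}`. -/
noncomputable def lnLNrm (n : ℕ) (r : ℝ) (E : KotheSpace) (α : ℕ → ℂ) : ℝ :=
  sSup {s | ∃ z : Fin n → ℕ → ℂ,
    (∀ i, Summable (fun k => ‖z i k‖ ^ r) ∧ (∑' k, ‖z i k‖ ^ r) ^ (1 / r) ≤ 1) ∧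
    s = E.nrm fun k => α k * ∏ i, z i k}

section WeakLp

variable {X : Type*} [NormedAddCommGroup X] [NormedSpace ℂ X] {m : ℕ} {p : ℝ}

theorem le_weakLp (hp : 0 < p) (x : Fin m → X) {f : X →L[ℂ] ℂ} (hf : ‖f‖ ≤ 1) :
    (∑ i, ‖f (x i)‖ ^ p) ^ (1 / p) ≤ weakLp p x := by
  refine le_csSup ⟨(∑ i, ‖x i‖ ^ p) ^ (1 / p), ?_⟩ ⟨f, hf, rfl⟩
  rintro _ ⟨g, hg, rfl⟩
  gcongr with i
  exact g.le_of_opNorm_le_of_le hg le_rfl |>.trans_eq (one_mul _)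

theorem weakLp_nonneg (p : ℝ) (x : Fin m → X) : 0 ≤ weakLp p x := by
  refine Real.sSup_nonneg ?_
  rintro _ ⟨f, -, rfl⟩
  positivity

theorem weakLp_le {x : Fin m → X} {M : ℝ}
    (h : ∀ f : X →L[ℂ] ℂ, ‖f‖ ≤ 1 → (∑ i, ‖f (x i)‖ ^ p) ^ (1 / p) ≤ M) :
    weakLp p x ≤ M := by
  refine csSup_le ⟨_, 0, by simp, rfl⟩ ?_
  rintro _ ⟨f, hf, rfl⟩
  exact h f hf

theorem sum_rpow_le_weakLp_rpow (hp : 0 < p) (x : Fin m → X) {f : X →L[ℂ] ℂ} (hf : ‖f‖ ≤ 1) :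
    ∑ i, ‖f (x i)‖ ^ p ≤ weakLp p x ^ p := by
  have h := le_weakLp hp x hf
  rwa [one_div, Real.rpow_inv_le_iff_of_pos (by positivity) (weakLp_nonneg p x) hp] at h

theorem weakLp_rpow_le (hp : 0 < p) {x : Fin m → X} {M : ℝ}
    (h : ∀ f : X →L[ℂ] ℂ, ‖f‖ ≤ 1 → ∑ i, ‖f (x i)‖ ^ p ≤ M) :
    weakLp p x ^ p ≤ M := by
  have hM : 0 ≤ M := le_trans (by positivity) (h 0 (by simp))
  rw [← Real.le_rpow_inv_iff_of_pos (weakLp_nonneg p x) hM hp]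
  refine weakLp_le fun f hf => ?_
  rw [one_div]
  gcongr
  exact h f hf

end WeakLp

open scoped BoundedContinuousFunction

section Pietsch

variable {X : Type*} [NormedAddCommGroup X] [NormedSpace ℂ X]

/-- The function `φ ↦ |φ(x)| ^ p` on the unit ball of the dual of `X`. -/
noncomputable def dualBallRpow (p : ℝ) (hp : 0 ≤ p) (x : X) :
    Metric.closedBall (0 : X →L[ℂ] ℂ) 1 →ᵇ ℝ :=
  BoundedContinuousFunction.ofNormedAddCommGroup (fun φ => ‖φ.1 x‖ ^ p)
    (by
      have : Continuous fun φ : Metric.closedBall (0 : X →L[ℂ] ℂ) 1 => φ.1 x := by fun_prop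
      exact this.norm.rpow_const fun _ => Or.inr hp)
    (‖x‖ ^ p)
    (fun φ => by
      rw [Real.norm_of_nonneg (by positivity)]
      gcongr
      exact φ.1.le_of_opNorm_le_of_le (mem_closedBall_zero_iff.1 φ.2) le_rfl
        |>.trans_eq (one_mul _))

@[simp]
theorem dualBallRpow_apply (p : ℝ) (hp : 0 ≤ p) (x : X)
    (φ : Metric.closedBall (0 : X →L[ℂ] ℂ) 1) : dualBallRpow p hp x φ = ‖φ.1 x‖ ^ p := rfl

/-- Pietsch domination, with a positive normalized functional in place of a measure. -/
theorem exists_pietsch_functional {Y : Type*} [NormedAddCommGroup Y] [NormedSpace ℂ Y]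
    (A : X →L[ℂ] Y) {r ρ : ℝ} (hr : 0 < r) (hρ : 0 ≤ ρ)
    (hA : ∀ (m : ℕ) (x : Fin m → X), (∑ i, ‖A (x i)‖ ^ r) ^ (1 / r) ≤ ρ * weakLp r x) :
    ∃ Λ : (Metric.closedBall (0 : X →L[ℂ] ℂ) 1 →ᵇ ℝ) →ₗ[ℝ] ℝ,
      (∀ f, (∀ φ, 0 ≤ f φ) → 0 ≤ Λ f) ∧ Λ 1 = 1 ∧
      ∀ x, ‖A x‖ ^ r ≤ ρ ^ r * Λ (dualBallRpow r hr.le x) := by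
  let s : PointedCone ℝ (Metric.closedBall (0 : X →L[ℂ] ℂ) 1 →ᵇ ℝ) :=
    { carrier := {h | ∃ (m : ℕ) (x : Fin m → X), ∀ φ : Metric.closedBall (0 : X →L[ℂ] ℂ) 1,
        ρ ^ r * ∑ i, ‖φ.1 (x i)‖ ^ r - ∑ i, ‖A (x i)‖ ^ r ≤ h φ}
      zero_mem' := ⟨0, Fin.elim0, fun φ => by simp⟩
      add_mem' := by
        rintro f g ⟨m, x, hx⟩ ⟨k, y, hy⟩
        refine ⟨m + k, Fin.append x y, fun φ => ?_⟩
        have h1 := hx φ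
        have h2 := hy φ
        simp only [Fin.sum_univ_add, Fin.append_left, Fin.append_right,
          BoundedContinuousFunction.add_apply]
        linarith
      smul_mem' := by
        rintro ⟨c, hc⟩ f ⟨m, x, hx⟩
        refine ⟨m, fun i => ((c ^ (1 / r) : ℝ) : ℂ) • x i, fun φ => ?_⟩
        have hcr : ∀ t : ℝ, 0 ≤ t → (c ^ (1 / r) * t) ^ r = c * t ^ r := fun t ht => by
          rw [Real.mul_rpow (by positivity) ht, ← Real.rpow_mul hc, one_div_mul_cancel hr.ne',
            Real.rpow_one]
        have hnn : ‖((c ^ (1 / r) : ℝ) : ℂ)‖ = c ^ (1 / r) := by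
          rw [Complex.norm_real, Real.norm_of_nonneg (by positivity)]
        have h1 := mul_le_mul_of_nonneg_left (hx φ) hc
        simp only [map_smul, norm_smul, hnn, hcr _ (norm_nonneg _), ← Finset.mul_sum]
        change _ ≤ c * f φ
        linarith }
  have h1ne : (1 : Metric.closedBall (0 : X →L[ℂ] ℂ) 1 →ᵇ ℝ) ≠ 0 := fun h => by
    simpa using DFunLike.congr_fun h ⟨0, by simp⟩
  let F : (Metric.closedBall (0 : X →L[ℂ] ℂ) 1 →ᵇ ℝ) →ₗ.[ℝ] ℝ :=
    LinearPMap.mkSpanSingleton 1 (1 : ℝ) h1ne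
  have hF : ∀ (c : ℝ) (h : c • (1 : Metric.closedBall (0 : X →L[ℂ] ℂ) 1 →ᵇ ℝ) ∈ F.domain),
      F ⟨c • 1, h⟩ = c := fun c h =>
    (LinearPMap.mkSpanSingleton'_apply _ _ _ c h).trans (by simp)
  obtain ⟨Λ, hΛ, hs⟩ := riesz_extension s F
    (by
      rintro ⟨f, hf⟩ hfs
      obtain ⟨c, rfl⟩ := Submodule.mem_span_singleton.1 hf
      rw [hF]
      obtain ⟨m, x, hx⟩ := hfs
      by_contra! hc
      have hAx : ∑ i, ‖A (x i)‖ ^ r ≤ ρ ^ r * weakLp r x ^ r := by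
        rw [← Real.mul_rpow hρ (weakLp_nonneg r x)]
        have := hA m x
        rwa [one_div, Real.rpow_inv_le_iff_of_pos (by positivity)
          (mul_nonneg hρ (weakLp_nonneg r x)) hr] at this
      have hx' : ∀ f : X →L[ℂ] ℂ, ‖f‖ ≤ 1 →
          ρ ^ r * ∑ i, ‖f (x i)‖ ^ r ≤ ∑ i, ‖A (x i)‖ ^ r + c := fun f hf => by
        have := hx ⟨f, mem_closedBall_zero_iff.2 hf⟩
        simp only [BoundedContinuousFunction.coe_smul, BoundedContinuousFunction.coe_one,
          Pi.one_apply, smul_eq_mul, mul_one] at this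
        linarith
      rcases (Real.rpow_nonneg hρ r).eq_or_lt' with h0 | h0
      · have := hx' 0 (by simp)
        rw [h0, zero_mul] at this hAx
        linarith
      · have := weakLp_rpow_le (M := (∑ i, ‖A (x i)‖ ^ r + c) / ρ ^ r) hr fun f hf => by
          rw [le_div_iff₀' h0]
          exact hx' f hf
        rw [le_div_iff₀' h0] at this
        linarith)
    (fun f => ⟨⟨‖f‖ • 1, Submodule.smul_mem _ _ (Submodule.mem_span_singleton_self _)⟩,
      0, Fin.elim0, fun φ => by
        have := f.neg_norm_le_apply φ
        simp
        linarith⟩)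
  have hone : Λ 1 = 1 := by
    have hm := Submodule.smul_mem _ (1 : ℝ) (Submodule.mem_span_singleton_self (R := ℝ)
      (1 : Metric.closedBall (0 : X →L[ℂ] ℂ) 1 →ᵇ ℝ))
    simpa using (hΛ ⟨_, hm⟩).trans (hF 1 hm)
  refine ⟨Λ, fun f hf => hs f ⟨0, Fin.elim0, fun φ => by simpa using hf φ⟩, hone, fun x => ?_⟩
  have := hs (ρ ^ r • dualBallRpow r hr.le x - ‖A x‖ ^ r • 1)
    ⟨1, fun _ => x, fun φ => by simp⟩
  rw [map_sub, map_smul, map_smul, hone] at this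
  simpa using this

end Pietsch

/-- A weighted three-factor Hölder inequality. -/
theorem sum_mul_mul_rpow_le {ι : Type*} (I : Finset ι) {p q r q' : ℝ} (hp : 1 ≤ p) (hr : 0 < r)
    (hqq : q.HolderConjugate q') (hpqr : 1 / r = 1 / p - 1 / q) {g s a : ι → ℝ}
    (hg : ∀ i, 0 ≤ g i) (hs : ∀ i, 0 ≤ s i) (ha : ∀ i, 0 ≤ a i) (hg1 : ∑ i ∈ I, g i ^ q' ≤ 1) :
    (∑ i ∈ I, g i * s i * a i) ^ r ≤
      (∑ i ∈ I, a i ^ p) ^ (r / q) * ∑ i ∈ I, g i ^ q' * (s i ^ r * a i ^ p) := by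
  have hp0 : 0 < p := by linarith
  have hq0 : 0 < q := hqq.pos
  have hq'0 : 0 < q' := hqq.symm.pos
  have hqr : p / q + p / r = 1 := by
    rw [div_eq_mul_one_div p r, hpqr]; field_simp; ring
  have hrq' : 1 ≤ r / q' := by
    have h1 : 1 / q' = 1 - 1 / q := by
      have := hqq.inv_add_inv_eq_one
      simp only [one_div]; linarith
    have h2 : 1 / p ≤ 1 := by rw [div_le_one hp0]; exact hp
    have h3 : 1 / r ≤ 1 / q' := by linarith
    rw [one_le_div hq'0]
    exact (one_div_le_one_div hr hq'0).1 h3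
  have hsum : ∑ i ∈ I, g i * s i * a i ≤
      (∑ i ∈ I, a i ^ p) ^ (1 / q) *
        (∑ i ∈ I, g i ^ q' * (s i * a i ^ (p / r)) ^ q') ^ (1 / q') := by
    have := Real.inner_le_Lp_mul_Lq_of_nonneg I hqq (f := fun i => a i ^ (p / q))
      (g := fun i => g i * (s i * a i ^ (p / r)))
      (fun i _ => Real.rpow_nonneg (ha i) _)
      (fun i _ => mul_nonneg (hg i) (mul_nonneg (hs i) (Real.rpow_nonneg (ha i) _)))
    have hprod : ∀ i, a i ^ (p / q) * (g i * (s i * a i ^ (p / r))) = g i * s i * a i := fun i => by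
      have : a i ^ (p / q) * a i ^ (p / r) = a i := by
        rw [← Real.rpow_add_of_nonneg (ha i) (by positivity) (by positivity), hqr, Real.rpow_one]
      linear_combination g i * s i * this
    have hpow : ∀ i, (a i ^ (p / q)) ^ q = a i ^ p := fun i => by
      rw [← Real.rpow_mul (ha i), div_mul_cancel₀ _ hq0.ne']
    have hmul : ∀ i, (g i * (s i * a i ^ (p / r))) ^ q' = g i ^ q' * (s i * a i ^ (p / r)) ^ q' :=
      fun i => Real.mul_rpow (hg i) (mul_nonneg (hs i) (Real.rpow_nonneg (ha i) _))
    simpa only [hprod, hpow, hmul] using this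
  have hmean : ∑ i ∈ I, g i ^ q' * (s i * a i ^ (p / r)) ^ q' ≤
      (∑ i ∈ I, g i ^ q' * (s i ^ r * a i ^ p)) ^ (q' / r) := by
    refine (Real.inner_le_weight_mul_Lp_of_nonneg I hrq' _ _
      (fun i => Real.rpow_nonneg (hg i) _)
      (fun i => Real.rpow_nonneg (mul_nonneg (hs i) (Real.rpow_nonneg (ha i) _)) _)).trans ?_
    have h1 : (∑ i ∈ I, g i ^ q') ^ (1 - (r / q')⁻¹) ≤ 1 :=
      Real.rpow_le_one (Finset.sum_nonneg fun i _ => Real.rpow_nonneg (hg i) _) hg1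
        (sub_nonneg.2 (inv_le_one_of_one_le₀ hrq'))
    have h2 : ∀ i, ((s i * a i ^ (p / r)) ^ q') ^ (r / q') = s i ^ r * a i ^ p := fun i => by
      rw [← Real.rpow_mul (mul_nonneg (hs i) (Real.rpow_nonneg (ha i) _)),
        mul_div_cancel₀ _ hq'0.ne', Real.mul_rpow (hs i) (Real.rpow_nonneg (ha i) _),
        ← Real.rpow_mul (ha i), div_mul_cancel₀ _ hr.ne']
    simp only [h2]
    rw [← inv_div r q']
    refine mul_le_of_le_one_left (Real.rpow_nonneg (Finset.sum_nonneg fun i _ => ?_) _) h1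
    exact mul_nonneg (Real.rpow_nonneg (hg i) _)
      (mul_nonneg (Real.rpow_nonneg (hs i) _) (Real.rpow_nonneg (ha i) _))
  have hB : 0 ≤ ∑ i ∈ I, g i ^ q' * (s i ^ r * a i ^ p) := Finset.sum_nonneg fun i _ =>
    mul_nonneg (Real.rpow_nonneg (hg i) _)
      (mul_nonneg (Real.rpow_nonneg (hs i) _) (Real.rpow_nonneg (ha i) _))
  have hW : 0 ≤ ∑ i ∈ I, a i ^ p := Finset.sum_nonneg fun i _ => Real.rpow_nonneg (ha i) _
  have hM : 0 ≤ ∑ i ∈ I, g i ^ q' * (s i * a i ^ (p / r)) ^ q' := Finset.sum_nonneg fun i _ =>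
    mul_nonneg (Real.rpow_nonneg (hg i) _)
      (Real.rpow_nonneg (mul_nonneg (hs i) (Real.rpow_nonneg (ha i) _)) _)
  calc (∑ i ∈ I, g i * s i * a i) ^ r
      ≤ ((∑ i ∈ I, a i ^ p) ^ (1 / q) *
          ((∑ i ∈ I, g i ^ q' * (s i ^ r * a i ^ p)) ^ (q' / r)) ^ (1 / q')) ^ r := by
        refine Real.rpow_le_rpow (Finset.sum_nonneg fun i _ =>
          mul_nonneg (mul_nonneg (hg i) (hs i)) (ha i)) (hsum.trans ?_) hr.le
        gcongr
    _ = _ := by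
        rw [Real.mul_rpow (by positivity) (by positivity), ← Real.rpow_mul hB, ← Real.rpow_mul hB,
          ← Real.rpow_mul hW]
        congr 2
        · ring
        · convert Real.rpow_one _ using 2
          field_simp

/-- An absolutely `r`-summing operator maps a weakly `p`-summable family to the product of a
strongly `r`-summable scalar family and a weakly `q`-summable family. -/
theorem exists_factorization_of_rsumming {X Y : Type*} [NormedAddCommGroup X] [NormedSpace ℂ X]
    [NormedAddCommGroup Y] [NormedSpace ℂ Y] (A : X →L[ℂ] Y) {p q r ρ : ℝ} (hp : 1 ≤ p)
    (hpq : p < q) (hr : 1 / r = 1 / p - 1 / q) (hρ : 0 ≤ ρ)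
    (hA : ∀ (m : ℕ) (x : Fin m → X), (∑ i, ‖A (x i)‖ ^ r) ^ (1 / r) ≤ ρ * weakLp r x)
    {m : ℕ} (x : Fin m → X) :
    ∃ (τ : Fin m → ℝ) (y : Fin m → Y), (∀ i, 0 ≤ τ i) ∧ (∀ i, A (x i) = (τ i : ℂ) • y i) ∧
      ∑ i, τ i ^ r ≤ weakLp p x ^ p ∧ weakLp q y ≤ ρ * weakLp p x ^ (p / q) := by
  have hp0 : 0 < p := by linarith
  have hq0 : 0 < q := by linarith
  have hr0 : 0 < r := by
    rw [← one_div_pos, hr, sub_pos]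
    exact one_div_lt_one_div_of_lt hp0 hpq
  have hpr : p ≤ r := by
    rw [← one_div_le_one_div hr0 hp0, hr]
    have : 0 < 1 / q := by positivity
    linarith
  have hqq := Real.HolderConjugate.conjExponent (lt_of_le_of_lt hp hpq)
  obtain ⟨Λ, hpos, hone, hdom⟩ := exists_pietsch_functional A hr0 hρ hA
  have hmono : ∀ f g, (∀ φ, f φ ≤ g φ) → Λ f ≤ Λ g := fun f g hfg => by
    have := hpos (g - f) fun φ => by simpa using hfg φ
    rw [map_sub] at this
    linarith
  set W := weakLp p x
  have hW : 0 ≤ W := weakLp_nonneg p x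
  let L : Fin m → ℝ := fun i => Λ (dualBallRpow p hp0.le (x i))
  have hL : ∀ i, 0 ≤ L i := fun i => hpos _ fun φ => by
    simp only [dualBallRpow_apply]; positivity
  have hτr : ∀ i, (L i ^ (1 / r)) ^ r = L i := fun i => by
    rw [← Real.rpow_mul (hL i), one_div_mul_cancel hr0.ne', Real.rpow_one]
  have hτ : ∀ i, 0 ≤ L i ^ (1 / r) := fun i => Real.rpow_nonneg (hL i) _
  refine ⟨fun i => L i ^ (1 / r), fun i => ((L i ^ (1 / r) : ℝ) : ℂ)⁻¹ • A (x i), hτ,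
    fun i => ?_, ?_, ?_⟩
  · change A (x i) = ((L i ^ (1 / r) : ℝ) : ℂ) • ((L i ^ (1 / r) : ℝ) : ℂ)⁻¹ • A (x i)
    by_cases h : L i ^ (1 / r) = 0
    · have hLi : L i = 0 := by rw [← hτr i, h, Real.zero_rpow hr0.ne']
      have h1 : Λ (dualBallRpow r hr0.le (x i)) ≤ ‖x i‖ ^ (r - p) * L i := by
        rw [← smul_eq_mul, ← map_smul]
        refine hmono _ _ fun φ => ?_
        simp only [dualBallRpow_apply, BoundedContinuousFunction.coe_smul, smul_eq_mul]
        have hφ : ‖φ.1 (x i)‖ ≤ ‖x i‖ :=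
          φ.1.le_of_opNorm_le_of_le (mem_closedBall_zero_iff.1 φ.2) le_rfl
            |>.trans_eq (one_mul _)
        calc ‖φ.1 (x i)‖ ^ r = ‖φ.1 (x i)‖ ^ (r - p) * ‖φ.1 (x i)‖ ^ p := by
              rw [← Real.rpow_add_of_nonneg (norm_nonneg _) (by linarith) hp0.le, sub_add_cancel]
          _ ≤ _ := by
              gcongr
      rw [hLi, mul_zero] at h1
      have h2 : ‖A (x i)‖ ^ r ≤ 0 :=
        (hdom (x i)).trans (mul_nonpos_of_nonneg_of_nonpos (by positivity) h1)
      have h3 := (Real.rpow_eq_zero (norm_nonneg _) hr0.ne').1 (h2.antisymm (by positivity))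
      rw [norm_eq_zero] at h3
      simp [h3]
    · rw [smul_smul, mul_inv_cancel₀ (by exact_mod_cast h), one_smul]
  · simp only [hτr]
    calc ∑ i, L i = Λ (∑ i, dualBallRpow p hp0.le (x i)) := (map_sum Λ _ _).symm
      _ ≤ Λ (W ^ p • 1) := hmono _ _ fun φ => by
          simpa using sum_rpow_le_weakLp_rpow hp0 x (mem_closedBall_zero_iff.1 φ.2)
      _ = W ^ p := by rw [map_smul, hone, smul_eq_mul, mul_one]
  · refine weakLp_le fun f hf => ?_
    obtain ⟨⟨g, hg, hgsum⟩, -⟩ := NNReal.isGreatest_Lp Finset.univ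
      (fun i => ‖f (((L i ^ (1 / r) : ℝ) : ℂ)⁻¹ • A (x i))‖₊) hqq
    have hgsum : ∑ i, ‖f (((L i ^ (1 / r) : ℝ) : ℂ)⁻¹ • A (x i))‖ * g i =
        (∑ i, ‖f (((L i ^ (1 / r) : ℝ) : ℂ)⁻¹ • A (x i))‖ ^ q) ^ (1 / q) := by
      simpa only [NNReal.coe_sum, NNReal.coe_mul, NNReal.coe_rpow, coe_nnnorm] using
        congrArg NNReal.toReal hgsum
    have hg : ∑ i, (g i : ℝ) ^ q.conjExponent ≤ 1 := by exact_mod_cast hg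
    rw [← hgsum]
    choose e he1 he using fun i =>
      Complex.exists_norm_eq_mul_self (f (((L i ^ (1 / r) : ℝ) : ℂ)⁻¹ • A (x i)))
    let v : X := ∑ i, ((g i : ℂ) * e i * ((L i ^ (1 / r) : ℝ) : ℂ)⁻¹) • x i
    have hv : ((∑ i, ‖f (((L i ^ (1 / r) : ℝ) : ℂ)⁻¹ • A (x i))‖ * g i : ℝ) : ℂ) = f (A v) := by
      push_cast
      simp only [v, map_sum]
      refine Finset.sum_congr rfl fun i _ => ?_
      rw [he i]
      simp only [map_smul, smul_eq_mul]
      ring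
    have hsum_le : ∑ i, ‖f (((L i ^ (1 / r) : ℝ) : ℂ)⁻¹ • A (x i))‖ * g i ≤ ‖A v‖ := by
      have h1 : ‖f (A v)‖ ≤ ‖A v‖ := (f.le_of_opNorm_le_of_le hf le_rfl).trans_eq (one_mul _)
      rw [← hv, Complex.norm_real] at h1
      exact (le_abs_self _).trans h1
    refine hsum_le.trans ?_
    have hΛv : Λ (dualBallRpow r hr0.le v) ≤ (W ^ p) ^ (r / q) := by
      calc Λ (dualBallRpow r hr0.le v)
          ≤ Λ ((W ^ p) ^ (r / q) • ∑ i, ((g i : ℝ) ^ q.conjExponent *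
              ((L i ^ (1 / r))⁻¹) ^ r) • dualBallRpow p hp0.le (x i)) := hmono _ _ fun φ => by
            simp only [dualBallRpow_apply, BoundedContinuousFunction.coe_smul, smul_eq_mul,
              BoundedContinuousFunction.coe_sum, Finset.sum_apply, mul_assoc]
            have hφv : ‖φ.1 v‖ ≤ ∑ i, (g i : ℝ) * (L i ^ (1 / r))⁻¹ * ‖φ.1 (x i)‖ := by
              simp only [v, map_sum]
              refine (norm_sum_le _ _).trans (Finset.sum_le_sum fun i _ => ?_)
              rw [map_smul, norm_smul, norm_mul, norm_mul, he1, norm_inv, Complex.norm_real,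
                Complex.norm_real, Real.norm_of_nonneg (hτ i)]
              simp
            refine (Real.rpow_le_rpow (norm_nonneg _) hφv hr0.le).trans ?_
            refine (sum_mul_mul_rpow_le Finset.univ hp hr0 hqq hr (fun i => (g i).2)
              (fun i => inv_nonneg.2 (hτ i)) (fun i => norm_nonneg _) hg).trans ?_
            have hin := sum_rpow_le_weakLp_rpow hp0 x (mem_closedBall_zero_iff.1 φ.2)
            have hin0 : 0 ≤ ∑ i, ‖φ.1 (x i)‖ ^ p := by positivity
            refine mul_le_mul_of_nonneg_right
              (Real.rpow_le_rpow hin0 hin (by positivity)) (Finset.sum_nonneg fun i _ => ?_)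
            exact mul_nonneg (Real.rpow_nonneg (g i).2 _) (mul_nonneg
              (Real.rpow_nonneg (inv_nonneg.2 (hτ i)) _) (by positivity))
        _ = (W ^ p) ^ (r / q) * ∑ i, (g i : ℝ) ^ q.conjExponent *
              (((L i ^ (1 / r))⁻¹) ^ r * L i) := by
            simp only [map_smul, map_sum, smul_eq_mul, mul_assoc, L]
        _ ≤ (W ^ p) ^ (r / q) * 1 := by
            gcongr
            refine le_trans (Finset.sum_le_sum fun i _ => ?_) hg
            refine mul_le_of_le_one_right (by positivity) ?_
            rw [Real.inv_rpow (hτ i), hτr]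
            exact inv_mul_le_one
        _ = _ := mul_one _
    have hAv : ‖A v‖ ^ r ≤ (ρ * W ^ (p / q)) ^ r := by
      rw [Real.mul_rpow hρ (by positivity)]
      refine (hdom v).trans ?_
      gcongr
      refine hΛv.trans_eq ?_
      rw [← Real.rpow_mul hW, ← Real.rpow_mul hW]
      congr 1
      ring
    exact (Real.rpow_le_rpow_iff (norm_nonneg _) (by positivity) hr0).1 hAv

/-- Multiplying by `z₁⋯z_n` with `‖z_j‖_{ℓ_r} ≤ t_j` costs at most the factor `t₁⋯t_n` with
respect to the norm of `ℓ_n(𝓛; ℓ_r, E)`, on members of `E`. -/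
theorem KotheSpace.nrm_mul_prod_le {n : ℕ} {r : ℝ} (hr : 0 < r) (E : KotheSpace) {α : ℕ → ℂ}
    (hα : E.Mem α) {z : Fin n → ℕ → ℂ} {t : Fin n → ℝ} (ht : ∀ j, 0 ≤ t j)
    (hz : ∀ j, Summable fun k => ‖z j k‖ ^ r) (hzt : ∀ j, ∑' k, ‖z j k‖ ^ r ≤ t j ^ r) :
    E.Mem (fun k => α k * ∏ j, z j k) ∧
      E.nrm (fun k => α k * ∏ j, z j k) ≤ lnLNrm n r E α * ∏ j, t j := by
  have hunit : ∀ u : Fin n → ℕ → ℂ, (∀ j k, ‖u j k‖ ≤ 1) →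
      ∀ k, ‖α k * ∏ j, u j k‖ ≤ ‖α k‖ := fun u hu k => by
    rw [norm_mul, norm_prod]
    exact mul_le_of_le_one_right (norm_nonneg _)
      (Finset.prod_le_one (fun j _ => norm_nonneg _) fun j _ => hu j k)
  have hle : ∀ (u : ℕ → ℂ) (s : ℝ), 0 ≤ s → (Summable fun k => ‖u k‖ ^ r) →
      ∑' k, ‖u k‖ ^ r ≤ s ^ r → ∀ k, ‖u k‖ ≤ s := fun u s hs hu hus k =>
    (Real.rpow_le_rpow_iff (norm_nonneg _) hs hr).1
      ((hu.le_tsum k fun i _ => by positivity).trans hus)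
  let u : Fin n → ℕ → ℂ := fun j k => ((t j : ℝ) : ℂ)⁻¹ * z j k
  have hu : ∀ j k, ‖u j k‖ ^ r = (t j ^ r)⁻¹ * ‖z j k‖ ^ r := fun j k => by
    rw [norm_mul, norm_inv, Complex.norm_real, Real.norm_of_nonneg (ht j),
      Real.mul_rpow (inv_nonneg.2 (ht j)) (norm_nonneg _), Real.inv_rpow (ht j)]
  have husum : ∀ j, Summable fun k => ‖u j k‖ ^ r := fun j => by
    simp only [hu]
    exact (hz j).mul_left _
  have hu1 : ∀ j, ∑' k, ‖u j k‖ ^ r ≤ 1 := fun j => by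
    simp only [hu, tsum_mul_left]
    exact (mul_le_mul_of_nonneg_left (hzt j)
      (inv_nonneg.2 (Real.rpow_nonneg (ht j) _))).trans inv_mul_le_one
  have hzu : ∀ j k, z j k = (t j : ℂ) * u j k := fun j k => by
    by_cases h : t j = 0
    · have := hle (z j) (t j) (ht j) (hz j) (hzt j) k
      rw [h] at this
      rw [h, norm_le_zero_iff.1 this]
      simp
    · rw [mul_inv_cancel_left₀ (by exact_mod_cast h)]
  have hmem : ∀ w : Fin n → ℕ → ℂ, (∀ j k, ‖w j k‖ ≤ 1) → E.Mem fun k => α k * ∏ j, w j k :=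
    fun w hw => E.normal_mem hα (hunit w hw)
  have hw1 : ∀ w : ℕ → ℂ, (Summable fun k => ‖w k‖ ^ r) → ∑' k, ‖w k‖ ^ r ≤ 1 →
      ∀ k, ‖w k‖ ≤ 1 := fun w hw hw' =>
    hle w 1 zero_le_one hw (by simpa using hw')
  have hEu := hmem u fun j => hw1 _ (husum j) (hu1 j)
  have heq : (fun k => α k * ∏ j, z j k) =
      ((∏ j, t j : ℝ) : ℂ) • fun k => α k * ∏ j, u j k := by
    funext k
    simp only [hzu, Finset.prod_mul_distrib, Pi.smul_apply, smul_eq_mul]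
    push_cast
    ring
  have ht' : 0 ≤ ∏ j, t j := Finset.prod_nonneg fun j _ => ht j
  rw [heq]
  refine ⟨E.mem_smul _ hEu, ?_⟩
  rw [E.nrm_smul _ hEu, Complex.norm_real, Real.norm_of_nonneg ht', mul_comm]
  refine mul_le_mul_of_nonneg_right (le_csSup ⟨E.nrm α, ?_⟩ ⟨u, fun j => ⟨husum j, ?_⟩, rfl⟩) ht'
  · rintro _ ⟨w, hw, rfl⟩
    have hw' : ∀ j k, ‖w j k‖ ≤ 1 := fun j => hw1 _ (hw j).1 <| by
      have h0 : 0 ≤ ∑' k, ‖w j k‖ ^ r := tsum_nonneg fun k => by positivity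
      have := (hw j).2
      rwa [one_div, Real.rpow_inv_le_iff_of_pos h0 zero_le_one hr, Real.one_rpow] at this
    exact E.normal_nrm (hmem w hw') hα (hunit w hw')
  · exact Real.rpow_le_one (tsum_nonneg fun k => by positivity) (hu1 j) (by positivity)

/-- Composition theorem for `(E,p)`-summing multilinear mappings, part (i):
if `T` is `(ℓ_n(𝓛;ℓ_r,E), q)`-summing with constant `C` and each `A_j` is absolutely
`r`-summing with constant `ρ_j` (where `1/r = 1/p - 1/q`), then `T∘(A_1,…,A_n)` is
`(E,p)`-summing with constant `C·ρ_1⋯ρ_n`. -/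
theorem summing_comp_rsumming (n : ℕ) (hn : 1 ≤ n) (p q r : ℝ) (hp : 1 ≤ p) (hpq : p < q)
    (hr : 1 / r = 1 / p - 1 / q) (E : KotheSpace)
    (hE : ∀ x : ℕ → ℂ, Summable (fun k => ‖x k‖ ^ p) →
      E.Mem (fun k => Complex.ofReal (‖x k‖ ^ n)))
    {X Y : Fin n → Type*} [∀ j, NormedAddCommGroup (X j)] [∀ j, NormedSpace ℂ (X j)]
    [∀ j, NormedAddCommGroup (Y j)] [∀ j, NormedSpace ℂ (Y j)]
    {Z : Type*} [NormedAddCommGroup Z] [NormedSpace ℂ Z]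
    (T : ContinuousMultilinearMap ℂ Y Z) (C : ℝ) (hC : 0 ≤ C)
    (hT : SummingIneq (lnLMem n r E) (lnLNrm n r E) q T C)
    (A : ∀ j, X j →L[ℂ] Y j) (ρ : Fin n → ℝ) (hρ : ∀ j, 0 ≤ ρ j)
    (hA : ∀ j (m : ℕ) (x : Fin m → X j),
      (∑ i, ‖A j (x i)‖ ^ r) ^ (1 / r) ≤ ρ j * weakLp r x) :
    SummingIneq E.Mem E.nrm p (T.compContinuousLinearMap A) (C * ∏ j, ρ j) := by
  have hp0 : 0 < p := by linarith
  have hq0 : 0 < q := by linarith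
  have hr0 : 0 < r := by
    rw [← one_div_pos, hr, sub_pos]
    exact one_div_lt_one_div_of_lt hp0 hpq
  intro m x
  choose τ y hτ hAx hτsum hy using fun j =>
    exists_factorization_of_rsumming (A j) hp hpq hr (hρ j) (hA j) (x j)
  let α : ℕ → ℂ := fun i =>
    if h : i < m then Complex.ofReal ‖T (fun j => y j ⟨i, h⟩)‖ else 0
  let z : Fin n → ℕ → ℂ := fun j k => if h : k < m then Complex.ofReal (τ j ⟨k, h⟩) else 0
  have hα : E.Mem α := E.l1_mem <| summable_of_ne_finset_zero (s := Finset.range m) fun k hk => by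
    simp only [Finset.mem_range] at hk
    simp [α, hk]
  have hz0 : ∀ j, ∀ k ∉ Finset.range m, ‖z j k‖ ^ r = 0 := fun j k hk => by
    simp only [Finset.mem_range] at hk
    simp [z, hk, hr0.ne']
  have hz : ∀ j, Summable fun k => ‖z j k‖ ^ r := fun j => summable_of_ne_finset_zero (hz0 j)
  have hzt : ∀ j, ∑' k, ‖z j k‖ ^ r ≤ (weakLp p (x j) ^ (p / r)) ^ r := fun j => by
    rw [tsum_eq_sum (hz0 j), Finset.sum_range, ← Real.rpow_mul (weakLp_nonneg _ _),
      div_mul_cancel₀ _ hr0.ne']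
    refine le_trans (Finset.sum_le_sum fun i _ => ?_) (hτsum j)
    simp [z, abs_of_nonneg (hτ j i)]
  have heq : (fun i => if h : i < m then
      Complex.ofReal ‖T.compContinuousLinearMap A (fun j => x j ⟨i, h⟩)‖ else 0) =
      fun k => α k * ∏ j, z j k := by
    funext k
    by_cases h : k < m
    · simp only [h, dif_pos, α, z, ContinuousMultilinearMap.compContinuousLinearMap_apply, hAx]
      rw [T.map_smul_univ, norm_smul, norm_prod]
      simp only [Complex.norm_real, Real.norm_of_nonneg (hτ _ _)]
      push_cast
      ring
    · simp [h, α]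
  rw [heq]
  obtain ⟨hmem, hle⟩ := E.nrm_mul_prod_le hr0 hα
    (fun j => Real.rpow_nonneg (weakLp_nonneg p (x j)) (p / r)) hz hzt
  refine ⟨hmem, hle.trans ?_⟩
  have hexp : p / q + p / r = 1 := by
    rw [div_eq_mul_one_div p r, hr]
    field_simp
    ring
  calc lnLNrm n r E α * ∏ j, weakLp p (x j) ^ (p / r)
      ≤ (C * ∏ j, (ρ j * weakLp p (x j) ^ (p / q))) * ∏ j, weakLp p (x j) ^ (p / r) := by
        have hw : ∀ j, 0 ≤ weakLp p (x j) := fun j => weakLp_nonneg p (x j)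
        refine mul_le_mul_of_nonneg_right ((hT m y).2.trans ?_)
          (Finset.prod_nonneg fun j _ => Real.rpow_nonneg (hw j) _)
        exact mul_le_mul_of_nonneg_left
          (Finset.prod_le_prod (fun j _ => weakLp_nonneg q (y j)) fun j _ => hy j) hC
    _ = C * (∏ j, ρ j) * ∏ j, weakLp p (x j) := by
        rw [mul_assoc, mul_assoc, ← Finset.prod_mul_distrib, ← Finset.prod_mul_distrib]
        congr 1
        refine Finset.prod_congr rfl fun j _ => ?_
        rw [mul_assoc, ← Real.rpow_add_of_nonneg (weakLp_nonneg p (x j)) (by positivity)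
          (by positivity), hexp, Real.rpow_one]
end
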